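/- Let F be a totally real number field of degree N over ℚ with class number one. There exists a constant C > 0, depending only on F, such that for every CM-field K whose maximal totally real subfield is F and every algebraic integer α ∈ O_K with α ∉ F, one has |N_{K/ℚ}(α)| ≥ C·Δ_K. -/

import Mathlib

open NumberField

open Polynomial Module

section

variable {F K : Type*} [Field F] [Field K] [Algebra F K]

lemma adjoin_singleton_eq_top_of_finrank_eq_two (h2 : finrank F K = 2) {α : K}
    (hα : ∀ a : F, algebraMap F K a ≠ α) : Algebra.adjoin F {α} = ⊤ := by
  have := Subalgebra.isSimpleOrder_of_finrank_prime F K (h2 ▸ Nat.prime_two)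
  refine (eq_bot_or_eq_top _).resolve_left fun h ↦ ?_
  have hmem : α ∈ (⊥ : Subalgebra F K) := h ▸ Algebra.self_mem_adjoin_singleton F α
  obtain ⟨a, ha⟩ := Algebra.mem_bot.mp hmem
  exact hα a ha

/-- A generator of `K` over a totally real subfield has no real conjugate when `K` has no real
embedding. -/
lemma im_ne_zero_of_adjoin_eq_top (hF : ∀ φ : F →+* ℂ, ∀ z : F, (φ z).im = 0)
    (hK : IsEmpty (K →+* ℝ)) {α : K} (hα : Algebra.adjoin F {α} = ⊤) (φ : K →+* ℂ) :
    (φ α).im ≠ 0 := by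
  intro him
  refine hK.false (ComplexEmbedding.IsReal.embedding (φ := φ) ?_)
  rw [ComplexEmbedding.isReal_iff]
  ext x
  have hx : x ∈ Algebra.adjoin F {α} := hα ▸ Algebra.mem_top
  rw [ComplexEmbedding.conjugate_coe_eq]
  induction hx using Algebra.adjoin_induction with
  | mem x hx =>
    rw [Set.mem_singleton_iff.mp hx]
    exact Complex.conj_eq_iff_im.mpr him
  | algebraMap r => exact Complex.conj_eq_iff_im.mpr (hF (φ.comp (algebraMap F K)) r)
  | add x y _ _ hx hy => simp only [map_add, hx, hy]
  | mul x y _ _ hx hy => simp only [map_mul, hx, hy]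

/-- The complex conjugate of a nonreal root of a real quadratic is the other root. -/
lemma two_mul_add_eq_sub_conj {z b c : ℂ} (hz : z.im ≠ 0) (hb : b.im = 0) (hc : c.im = 0)
    (h : z ^ 2 + b * z + c = 0) : 2 * z + b = z - starRingEnd ℂ z := by
  have h' := congrArg (starRingEnd ℂ) h
  simp only [map_add, map_mul, map_pow, map_zero, Complex.conj_eq_iff_im.mpr hb,
    Complex.conj_eq_iff_im.mpr hc] at h'
  have hne : z - starRingEnd ℂ z ≠ 0 :=
    sub_ne_zero.mpr fun h0 ↦ hz (Complex.conj_eq_iff_im.mp h0.symm)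
  refine mul_left_cancel₀ hne ?_
  linear_combination h - h'

end

section

variable {F K : Type*} [Field F] [NumberField F] [Field K] [NumberField K] [Algebra F K]

/-- The relative different of a totally imaginary quadratic extension of a totally real field
contains the difference between any integral generator and its complex conjugate. -/
lemma exists_mem_differentIdeal_eq_sub_conj (hF : ∀ φ : F →+* ℂ, ∀ z : F, (φ z).im = 0)
    (h2 : finrank F K = 2) (hK : IsEmpty (K →+* ℝ)) {α : 𝓞 K}
    (hα : ∀ a : F, algebraMap F K a ≠ (α : K)) :
    ∃ x ∈ differentIdeal (𝓞 F) (𝓞 K), x ≠ 0 ∧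
      ∀ φ : K →+* ℂ, φ x = φ α - starRingEnd ℂ (φ α) := by
  have htop := adjoin_singleton_eq_top_of_finrank_eq_two h2 hα
  have him := im_ne_zero_of_adjoin_eq_top hF hK htop
  have hint : IsIntegral (𝓞 F) α := Algebra.IsIntegral.isIntegral α
  have hmonic : (minpoly (𝓞 F) α).Monic := minpoly.monic hint
  have hdeg : (minpoly (𝓞 F) α).natDegree = 2 := by
    have h := minpoly.isIntegrallyClosed_eq_field_fractions F K hint
    have hd := congrArg natDegree h
    rw [hmonic.natDegree_map] at hd
    rw [← hd, ← h2, ← IntermediateField.adjoin.finrank (.of_finite F _),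
      IntermediateField.adjoin_eq_top_of_algebra F _ htop, IntermediateField.finrank_top']
  set b := (minpoly (𝓞 F) α).coeff 1
  set c := (minpoly (𝓞 F) α).coeff 0
  have hpoly : minpoly (𝓞 F) α = X ^ 2 + C b * X + C c := by
    conv_lhs => rw [hmonic.as_sum, hdeg]
    simp only [Finset.sum_range_succ, Finset.sum_range_zero, b, c]
    ring
  have hroot : α ^ 2 + algebraMap (𝓞 F) (𝓞 K) b * α + algebraMap (𝓞 F) (𝓞 K) c = 0 := by
    have := minpoly.aeval (𝓞 F) α
    rw [hpoly] at this
    simpa using this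
  have hmem := aeval_derivative_mem_differentIdeal (𝓞 F) F K α htop
  have hder : aeval α (derivative (minpoly (𝓞 F) α)) =
      2 * α + algebraMap (𝓞 F) (𝓞 K) b := by
    rw [hpoly]
    simp [one_add_one_eq_two, map_ofNat]
  rw [hder] at hmem
  have hreal (φ : K →+* ℂ) (r : 𝓞 F) : (φ (algebraMap (𝓞 F) (𝓞 K) r : 𝓞 K)).im = 0 :=
    hF (φ.comp (algebraMap F K)) r
  have hφ (φ : K →+* ℂ) : φ (2 * α + algebraMap (𝓞 F) (𝓞 K) b : 𝓞 K) =
      φ α - starRingEnd ℂ (φ α) := by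
    rw [← two_mul_add_eq_sub_conj (him φ) (hreal φ b) (hreal φ c)
      (by simpa using congrArg (fun y : 𝓞 K ↦ φ y) hroot)]
    simp [map_ofNat]
  refine ⟨_, hmem, fun h0 ↦ ?_, hφ⟩
  obtain ⟨φ⟩ := (inferInstance : Nonempty (K →+* ℂ))
  have h := hφ φ
  rw [h0] at h
  refine him φ (Complex.conj_eq_iff_im.mp ?_)
  exact (sub_eq_zero.mp (h.symm.trans (by simp))).symm

lemma abs_norm_le_of_forall_norm_embedding_le {x y : K} {c : ℝ}
    (h : ∀ φ : K →+* ℂ, ‖φ x‖ ≤ c * ‖φ y‖) :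
    |((Algebra.norm ℚ x : ℚ) : ℝ)| ≤ c ^ finrank ℚ K * |((Algebra.norm ℚ y : ℚ) : ℝ)| := by
  have key (z : K) : |((Algebra.norm ℚ z : ℚ) : ℝ)| = ∏ σ : K →ₐ[ℚ] ℂ, ‖σ z‖ := by
    rw [← norm_prod, ← Algebra.norm_eq_prod_embeddings, eq_ratCast, Complex.norm_ratCast]
  rw [key, key, ← AlgHom.card ℚ K ℂ, ← Finset.card_univ, ← Finset.prod_const,
    ← Finset.prod_mul_distrib]
  exact Finset.prod_le_prod (fun _ _ ↦ norm_nonneg _) fun σ _ ↦ h σ.toRingHom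

lemma absNorm_le_abs_norm_of_mem {I : Ideal (𝓞 K)} {x : 𝓞 K} (hx : x ∈ I) (h0 : x ≠ 0) :
    (I.absNorm : ℝ) ≤ |((Algebra.norm ℚ (x : K) : ℚ) : ℝ)| := by
  have hdvd := Ideal.absNorm_dvd_absNorm_of_le ((Ideal.span_singleton_le_iff_mem I).mpr hx)
  rw [Ideal.absNorm_span_singleton] at hdvd
  have hle := Nat.le_of_dvd
    (Int.natAbs_pos.mpr (Algebra.norm_ne_zero_iff.mpr h0)) hdvd
  rw [← Algebra.coe_norm_int, Rat.cast_intCast, ← Int.cast_abs, ← Nat.cast_natAbs]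
  exact_mod_cast hle

end

/-- let `F` be a totally real number field of degree `N` over `ℚ` with class
number one. There is a constant `C > 0` depending only on `F` such that for every CM-field
`K` with maximal totally real subfield `F` and every algebraic integer `α ∈ O_K` with
`α ∉ F`, one has `|N_{K/ℚ}(α)| ≥ C·Δ_K`. -/
theorem stmt_8.{u, v} (F : Type u) [Field F] [NumberField F] (N : ℕ)
    (hN : Module.finrank ℚ F = N)
    (hTR : ∀ φ : F →+* ℂ, ∀ z : F, (φ z).im = 0)
    (hcl : NumberField.classNumber F = 1) :
    ∃ C : ℝ, 0 < C ∧
      ∀ (K : Type v) [Field K] [NumberField K] [Algebra F K],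
        Module.finrank F K = 2 →
        IsEmpty (K →+* ℝ) →
        ∀ α : 𝓞 K, (∀ a : F, algebraMap F K a ≠ (α : K)) →
          C * ((NumberField.discr K).natAbs : ℝ) ≤ |((Algebra.norm ℚ (α : K) : ℚ) : ℝ)| := by
  have hd : 0 < ((discr F).natAbs : ℝ) :=
    Nat.cast_pos.mpr (Int.natAbs_pos.mpr (discr_ne_zero F))
  refine ⟨(2 ^ (N * 2) * ((discr F).natAbs : ℝ) ^ 2)⁻¹, by positivity, ?_⟩
  intro K _ _ _ h2 hK α hα
  obtain ⟨x, hx, hx0, hφ⟩ := exists_mem_differentIdeal_eq_sub_conj hTR h2 hK hα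
  have hnorm := abs_norm_le_of_forall_norm_embedding_le (x := (x : K)) (y := (α : K)) (c := 2)
    fun φ ↦ by
      rw [hφ, two_mul]
      exact (norm_sub_le _ _).trans_eq (by rw [RCLike.norm_conj])
  have : finrank ℚ K = N * 2 := by rw [← finrank_mul_finrank ℚ F K, hN, h2]
  rw [this] at hnorm
  have hle := (absNorm_le_abs_norm_of_mem hx hx0).trans hnorm
  rw [natAbs_discr_eq_absNorm_differentIdeal_mul_natAbs_discr_pow F (𝓞 F) K (𝓞 K), h2,
    inv_mul_le_iff₀ (by positivity)]
  push_cast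
  calc _ ≤ _ * ((discr F).natAbs : ℝ) ^ 2 := mul_le_mul_of_nonneg_right hle (by positivity)
    _ = _ := by ring
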